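/- Let T = △(e(1,0), e(0,1), e(1,1)) with e(1,0)+e(0,1)+e(1,1) = (0,0) and e(0,0) := (0,0). Let f : T → ℝ be twice continuously differentiable, let F_n : 𝔽₂^{n×2} → ℝ be its n-th discretized function, and let K ∈ 𝔽₂^{n×2} with v(K) ≥ 1. Then: (i) |R₀F̂_n(K)| ≤ 2√2·d(T)·‖f‖_{C²(T)}/2^{2v(K)}; (ii) |R_wF̂_n(K)| ≤ 4·d(T)²·‖f‖_{C²(T)}/2^{2v(K)} for every 1 ≤ w ≤ v(K)−1; and (iii) |F̂_n(K)| ≤ max(2√2·d(T), 4·d(T)²)·‖f‖_{C²(T)}·v(K)/2^{2v(K)}, where F̂_n(K) is the K-th Walsh coefficient of F_n and d(T) is the diameter of T. -/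

import Mathlib

open MeasureTheory

noncomputable section

/-- The two-element field. -/
abbrev F2 : Type := ZMod 2

/-- Points of the plane. -/
abbrev Pt : Type := EuclideanSpace ℝ (Fin 2)

/-- The (closed) triangle with vertices `A`, `B`, `C`. -/
def tri (A B C : Pt) : Set Pt :=
  {x | ∃ w1 w2 w3 : ℝ, 0 ≤ w1 ∧ 0 ≤ w2 ∧ 0 ≤ w3 ∧ w1 + w2 + w3 = 1 ∧
    x = w1 • A + w2 • B + w3 • C}

/-- One step of the recursive partitioning, acting on vertex triples `(A,B,C)`. -/
def subV (v : Pt × Pt × Pt) (ξ : F2 × F2) : Pt × Pt × Pt :=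
  if ξ = (1, 0) then (v.1, (2:ℝ)⁻¹ • (v.1 + v.2.1), (2:ℝ)⁻¹ • (v.1 + v.2.2))
  else if ξ = (0, 1) then ((2:ℝ)⁻¹ • (v.2.1 + v.1), v.2.1, (2:ℝ)⁻¹ • (v.2.1 + v.2.2))
  else if ξ = (1, 1) then ((2:ℝ)⁻¹ • (v.2.2 + v.1), (2:ℝ)⁻¹ • (v.2.2 + v.2.1), v.2.2)
  else ((2:ℝ)⁻¹ • (v.2.1 + v.2.2), (2:ℝ)⁻¹ • (v.2.2 + v.1), (2:ℝ)⁻¹ • (v.1 + v.2.1))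

/-- Iterated partitioning along a list of pairs of bits (the rows of `X`). -/
def vIter (v : Pt × Pt × Pt) (l : List (F2 × F2)) : Pt × Pt × Pt := l.foldl subV v

/-- The subtriangle `T^{(n)}(X)` where `l` is the list of rows of `X`. -/
def subTri (v : Pt × Pt × Pt) (l : List (F2 × F2)) : Set Pt :=
  tri (vIter v l).1 (vIter v l).2.1 (vIter v l).2.2

/-- The centre `φ^{(n)}(X)` of the subtriangle `T^{(n)}(X)`. -/
def ctr (v : Pt × Pt × Pt) (l : List (F2 × F2)) : Pt :=
  (3:ℝ)⁻¹ • ((vIter v l).1 + (vIter v l).2.1 + (vIter v l).2.2)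

/-- The sign `η_i(X)` (with `i` 1-indexed, `1 ≤ i ≤ n+1`). -/
def eta {n : ℕ} (X : Fin n → F2 × F2) (i : ℕ) : ℝ :=
  (-1 : ℝ) ^ (Finset.univ.filter fun a : Fin n => (a : ℕ) + 1 < i ∧ X a = (0, 0)).card

/-- First coordinate direction. -/
def dir1 : Pt := EuclideanSpace.single 0 1

/-- Second coordinate direction. -/
def dir2 : Pt := EuclideanSpace.single 1 1

/-- Partial derivative (within `T`) of `f` in the direction `v`. -/
def pdW (T : Set Pt) (v : Pt) (f : Pt → ℝ) : Pt → ℝ := fun x => fderivWithin ℝ f T x v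

/-- Sup of `|g|` over `T`. -/
def supAbs (T : Set Pt) (g : Pt → ℝ) : ℝ := ⨆ x ∈ T, |g x|

/-- The norm `‖f‖_{C²(T)}`: the maximum over all partial derivatives of order at most 2
of the sup norm on `T`. -/
def c2Norm (T : Set Pt) (f : Pt → ℝ) : ℝ :=
  max (supAbs T f)
    (max (max (supAbs T (pdW T dir1 f)) (supAbs T (pdW T dir2 f)))
      (max (supAbs T (pdW T dir1 (pdW T dir1 f)))
        (max (supAbs T (pdW T dir2 (pdW T dir1 f)))
          (supAbs T (pdW T dir2 (pdW T dir2 f))))))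

/-- The `n`-th discretized function `F_n` of `f` (with `X` given by its rows). -/
def discF (v : Pt × Pt × Pt) {n : ℕ} (f : Pt → ℝ) (X : Fin n → F2 × F2) : ℝ :=
  (volume (subTri v (List.ofFn X))).toReal⁻¹ * ∫ y in subTri v (List.ofFn X), f y

/-- The `l`-th dyadic digit of `h`. -/
def digit (h l : ℕ) : F2 := if Nat.testBit h l then 1 else 0

/-- The weight `μ₁(k)` of a column vector: the largest (1-indexed) position of a
nonzero entry, and `0` for the zero vector. -/
def mu1 {n : ℕ} (k : Fin n → F2) : ℕ :=
  (Finset.univ.filter fun i : Fin n => k i ≠ 0).sup fun i => (i : ℕ) + 1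

/-- The weight `v(K) = max (μ₁(k₁), μ₁(k₂))` of `K` (given by its rows). -/
def vK {n : ℕ} (K : Fin n → F2 × F2) : ℕ :=
  max (mu1 fun i => (K i).1) (mu1 fun i => (K i).2)

/-- Entry `(i, j)` (0-indexed row `i`) of the point `X(h)` of the digital sequence with
generating matrices `Cm 0`, `Cm 1` (0-indexed). -/
def Xent (Cm : Fin 2 → ℕ → ℕ → F2) (h i : ℕ) (j : Fin 2) : F2 :=
  ∑ l ∈ Finset.range (h + 1), Cm j i l * digit h l

/-- Row `i` (0-indexed) of the point `X(h)` of the digital sequence. -/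
def XrowS (Cm : Fin 2 → ℕ → ℕ → F2) (h i : ℕ) : F2 × F2 :=
  (Xent Cm h i 0, Xent Cm h i 1)

/-- `ν(h)`: the number of initial rows of `X(h)` after which all rows vanish. -/
def nuF (Cm : Fin 2 → ℕ → ℕ → F2) (h : ℕ) : ℕ :=
  sInf {q | ∀ i, q ≤ i → XrowS Cm h i = (0, 0)}

/-- The `h`-th point of the sequence `S_T` in the triangle with vertex triple `v`. -/
def seqPt (v : Pt × Pt × Pt) (Cm : Fin 2 → ℕ → ℕ → F2) (h : ℕ) : Pt :=
  ctr v (List.ofFn fun i : Fin (nuF Cm h) => XrowS Cm h (i : ℕ))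

/-- Row `i` of the digital-net point `X(h)` for generating matrices `C1 C2 ∈ 𝔽₂^{n×m}`. -/
def XnetRow {n m : ℕ} (C1 C2 : Matrix (Fin n) (Fin m) F2) (h : ℕ) (i : Fin n) : F2 × F2 :=
  (∑ l : Fin m, C1 i l * digit h (l : ℕ), ∑ l : Fin m, C2 i l * digit h (l : ℕ))

/-- The Walsh function `wal_K(X)` (for `K`, `X` given by their rows). -/
def walR {n : ℕ} (K X : Fin n → F2 × F2) : ℝ :=
  (-1 : ℝ) ^ (∑ i : Fin n, ((K i).1 * (X i).1 + (K i).2 * (X i).2)).val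

/-- The `K`-th Walsh coefficient of `F : 𝔽₂^{n×2} → ℝ`. -/
def fhat {n : ℕ} (F : (Fin n → F2 × F2) → ℝ) (K : Fin n → F2 × F2) : ℝ :=
  ((4:ℝ) ^ n)⁻¹ * ∑ X : Fin n → F2 × F2, F X * walR K X

/-- The vector `τ(κ, κ')`. -/
def tau (e : F2 × F2 → Pt) (κ κ' : F2 × F2) : Pt :=
  if κ' ≠ (0, 0) ∧ κ' ≠ κ then e (κ + κ') - e κ' else e (κ + κ') + e κ'

/-- The point shift `y ⊕_i κ` on `T^{(n)}(X)` (with `i : Fin n` the 0-indexed row,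
corresponding to the 1-indexed row `i+1` of the paper). -/
def ptShift (e : F2 × F2 → Pt) {n : ℕ} (X : Fin n → F2 × F2) (i : Fin n)
    (κ : F2 × F2) (y : Pt) : Pt :=
  if X i ≠ (0, 0) ∧ X i ≠ κ then
    y + (eta X ((i : ℕ) + 1) / 2 ^ ((i : ℕ) + 1)) • tau e κ (X i)
  else
    (2:ℝ) • ctr (e (1, 0), e (0, 1), e (1, 1)) ((List.ofFn X).take (i : ℕ)) - y +
      (eta X ((i : ℕ) + 1) / 2 ^ ((i : ℕ) + 1)) • tau e κ (X i)

/-- The map `σ : 𝔽₂² → 𝔽₂²`. -/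
def sigF : F2 × F2 → F2 × F2 := fun κ =>
  if κ = (0, 0) then (1, 1) else if κ = (1, 1) then (0, 1) else κ

/-- The two-element set `P(κ) = {p₁(κ), p₂(κ)}`. -/
def pSet (κ : F2 × F2) : Finset (F2 × F2) :=
  if κ = (0, 0) then {(0, 0), (1, 1)} else if κ = (0, 1) then {(1, 1), (1, 0)}
  else if κ = (1, 0) then {(1, 1), (0, 1)} else {(1, 0), (1, 1)}

/-- The one-row Walsh function `wal_κ(ξ)`. -/
def walRow (κ ξ : F2 × F2) : ℝ := (-1 : ℝ) ^ ((κ.1 * ξ.1 + κ.2 * ξ.2 : F2)).val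

/-- The `i`-th dyadic difference `d_K^{(i)} F` (with `i : Fin n` 0-indexed, corresponding
to the 1-indexed index `i+1` of the paper). -/
def dd {n : ℕ} (K : Fin n → F2 × F2) (i : Fin n) (F : (Fin n → F2 × F2) → ℝ) :
    (Fin n → F2 × F2) → ℝ :=
  fun X => F (Function.update X i (X i + sigF (K i))) + walRow (K i) (sigF (K i)) * F X

/-- The subset `R_w(K) ⊆ 𝔽₂^{n×2}` (here `w : ℕ` is the 1-indexed paper index,
`0 ≤ w ≤ v(K)-1`). -/
def Rset {n : ℕ} (K : Fin n → F2 × F2) (w : ℕ) : Finset (Fin n → F2 × F2) :=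
  Finset.univ.filter fun X =>
    (∀ i : Fin n, w ≤ (i : ℕ) → (i : ℕ) + 1 < vK K → X i ∉ pSet (K i)) ∧
    (w = 0 ∨ ∃ j : Fin n, (j : ℕ) + 1 = w ∧ X j ∈ pSet (K j))

/-- The Walsh coefficient of `F` on the subset `R_w(K)`. -/
def rwHat {n : ℕ} (F : (Fin n → F2 × F2) → ℝ) (K : Fin n → F2 × F2) (w : ℕ) : ℝ :=
  ((4:ℝ) ^ n)⁻¹ * ∑ X ∈ Rset K w, F X * walR K X


/-- The orientation of the subtriangle selected by a row: only the central one is reversed. -/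
def rowSign (ξ : F2 × F2) : ℝ := if ξ = (0, 0) then -1 else 1

/-- The similarity mapping the centred triangle onto its subtriangle selected by `ξ`. -/
def rowMap (e : F2 × F2 → Pt) (ξ : F2 × F2) (z : Pt) : Pt :=
  (2:ℝ)⁻¹ • (rowSign ξ • z + e ξ)

/-- The similarity mapping the centred triangle onto its subtriangle selected by `l`. -/
def iterMap (e : F2 × F2 → Pt) (l : List (F2 × F2)) (z : Pt) : Pt :=
  l.foldr (rowMap e) z

/-- The centred triangle itself. -/
def baseTri (e : F2 × F2 → Pt) : Set Pt := tri (e (1, 0)) (e (0, 1)) (e (1, 1))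

lemma row_cases : ∀ ξ : F2 × F2, ξ = (0, 0) ∨ ξ = (1, 0) ∨ ξ = (0, 1) ∨ ξ = (1, 1) := by
  decide

lemma rowSign_eq (ξ : F2 × F2) : rowSign ξ = 1 ∨ rowSign ξ = -1 := by
  unfold rowSign; split_ifs <;> simp

lemma subV_rowMap (e : F2 × F2 → Pt) (ξ ζ : F2 × F2) (v : Pt × Pt × Pt) :
    subV (rowMap e ξ v.1, rowMap e ξ v.2.1, rowMap e ξ v.2.2) ζ =
      (rowMap e ξ (subV v ζ).1, rowMap e ξ (subV v ζ).2.1, rowMap e ξ (subV v ζ).2.2) := by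
  rcases row_cases ζ with rfl | rfl | rfl | rfl <;>
    simp only [subV, rowMap, Prod.mk.injEq, one_ne_zero, zero_ne_one, and_self, and_false,
      if_true, if_false, true_and, and_true] <;>
    (try constructor) <;> (try constructor) <;> module

lemma vIter_rowMap (e : F2 × F2 → Pt) (ξ : F2 × F2) (l : List (F2 × F2)) (v : Pt × Pt × Pt) :
    vIter (rowMap e ξ v.1, rowMap e ξ v.2.1, rowMap e ξ v.2.2) l =
      (rowMap e ξ (vIter v l).1, rowMap e ξ (vIter v l).2.1, rowMap e ξ (vIter v l).2.2) := by
  induction l generalizing v with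
  | nil => rfl
  | cons ζ l ih =>
    have h := ih (subV v ζ)
    rw [← subV_rowMap] at h
    exact h

lemma subV_base (e : F2 × F2 → Pt) (he0 : e (0, 0) = 0)
    (hsum : e (1, 0) + e (0, 1) + e (1, 1) = 0) (ξ : F2 × F2) :
    subV (e (1, 0), e (0, 1), e (1, 1)) ξ =
      (rowMap e ξ (e (1, 0)), rowMap e ξ (e (0, 1)), rowMap e ξ (e (1, 1))) := by
  have h3 : e (1, 1) = -(e (1, 0) + e (0, 1)) := by
    rw [eq_neg_iff_add_eq_zero, add_comm]; exact hsum
  rcases row_cases ξ with rfl | rfl | rfl | rfl <;>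
    simp only [subV, rowMap, rowSign, he0, h3, Prod.mk.injEq, one_ne_zero, zero_ne_one, and_self,
      and_false, if_true, if_false, and_true] <;>
    (try constructor) <;> (try constructor) <;> module

lemma vIter_base (e : F2 × F2 → Pt) (he0 : e (0, 0) = 0)
    (hsum : e (1, 0) + e (0, 1) + e (1, 1) = 0) (l : List (F2 × F2)) :
    vIter (e (1, 0), e (0, 1), e (1, 1)) l =
      (iterMap e l (e (1, 0)), iterMap e l (e (0, 1)), iterMap e l (e (1, 1))) := by
  induction l with
  | nil => rfl
  | cons ξ l ih =>
    have h := vIter_rowMap e ξ l (e (1, 0), e (0, 1), e (1, 1))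
    rw [← subV_base e he0 hsum, ih] at h
    exact h

lemma iterMap_eq (e : F2 × F2 → Pt) (l : List (F2 × F2)) :
    ∃ (r : ℝ) (c : Pt), |r| = (2 ^ l.length)⁻¹ ∧ ∀ z, iterMap e l z = r • z + c := by
  induction l with
  | nil => exact ⟨1, 0, by simp, fun z => by simp [iterMap]⟩
  | cons ξ l ih =>
    obtain ⟨r, c, hr, h⟩ := ih
    refine ⟨2⁻¹ * (rowSign ξ * r), (2:ℝ)⁻¹ • (rowSign ξ • c + e ξ), ?_, fun z => ?_⟩
    · have : |rowSign ξ| = 1 := by rcases rowSign_eq ξ with h | h <;> simp [h]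
      rw [abs_mul, abs_mul, this, hr, List.length_cons, pow_succ, mul_inv, abs_of_pos (by norm_num)]
      ring
    · have h' : iterMap e (ξ :: l) z = rowMap e ξ (iterMap e l z) := rfl
      rw [h', h, rowMap]
      module

lemma norm_iterMap_sub (e : F2 × F2 → Pt) (l : List (F2 × F2)) (z z' : Pt) :
    ‖iterMap e l z - iterMap e l z'‖ = (2 ^ l.length)⁻¹ * ‖z - z'‖ := by
  obtain ⟨r, c, hr, h⟩ := iterMap_eq e l
  rw [h, h, add_sub_add_right_eq_sub, ← smul_sub, norm_smul, Real.norm_eq_abs, hr]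

lemma convex_tri (A B C : Pt) : Convex ℝ (tri A B C) := by
  rintro _ ⟨a, b, c, ha, hb, hc, habc, rfl⟩ _ ⟨a', b', c', ha', hb', hc', habc', rfl⟩ s t hs ht hst
  refine ⟨s * a + t * a', s * b + t * b', s * c + t * c', by positivity, by positivity,
    by positivity, ?_, by module⟩
  linear_combination s * habc + t * habc' + hst

lemma tri_eq_convexHull (A B C : Pt) : tri A B C = convexHull ℝ (Set.range ![A, B, C]) := by
  apply Set.Subset.antisymm
  · rintro x ⟨a, b, c, ha, hb, hc, habc, rfl⟩
    have h := (convex_convexHull ℝ (Set.range ![A, B, C])).sum_mem (t := Finset.univ)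
      (w := ![a, b, c]) (z := ![A, B, C]) (by simp [Fin.forall_fin_succ, ha, hb, hc])
      (by simpa [Fin.sum_univ_three] using habc)
      (fun i _ => subset_convexHull ℝ _ (Set.mem_range_self i))
    simpa [Fin.sum_univ_three] using h
  · refine convexHull_min ?_ (convex_tri A B C)
    rintro _ ⟨i, rfl⟩
    fin_cases i
    · exact ⟨1, 0, 0, by norm_num, le_rfl, le_rfl, by norm_num, by simp⟩
    · exact ⟨0, 1, 0, le_rfl, by norm_num, le_rfl, by norm_num, by simp⟩
    · exact ⟨0, 0, 1, le_rfl, le_rfl, by norm_num, by norm_num, by simp⟩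

lemma isCompact_tri (A B C : Pt) : IsCompact (tri A B C) := by
  rw [tri_eq_convexHull]
  exact (Set.finite_range _).isCompact_convexHull ℝ

lemma interior_tri_nonempty {A B C : Pt} (h : AffineIndependent ℝ ![A, B, C]) :
    (interior (tri A B C)).Nonempty := by
  rw [tri_eq_convexHull, interior_convexHull_nonempty_iff_affineSpan_eq_top,
    h.affineSpan_eq_top_iff_card_eq_finrank_add_one]
  simp

lemma convex_baseTri (e : F2 × F2 → Pt) : Convex ℝ (baseTri e) := convex_tri _ _ _

lemma isCompact_baseTri (e : F2 × F2 → Pt) : IsCompact (baseTri e) := isCompact_tri _ _ _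

lemma interior_baseTri_nonempty {e : F2 × F2 → Pt}
    (h : AffineIndependent ℝ ![e (1, 0), e (0, 1), e (1, 1)]) :
    (interior (baseTri e)).Nonempty := interior_tri_nonempty h

lemma rowMap_mem (e : F2 × F2 → Pt) (he0 : e (0, 0) = 0)
    (hsum : e (1, 0) + e (0, 1) + e (1, 1) = 0) (ξ : F2 × F2) {z : Pt} (hz : z ∈ baseTri e) :
    rowMap e ξ z ∈ baseTri e := by
  have h3 : e (1, 1) = -(e (1, 0) + e (0, 1)) := by
    rw [eq_neg_iff_add_eq_zero, add_comm]; exact hsum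
  obtain ⟨a, b, c, ha, hb, hc, habc, rfl⟩ := hz
  rcases row_cases ξ with rfl | rfl | rfl | rfl
  · refine ⟨(1 - a) / 2, (1 - b) / 2, (1 - c) / 2, by linarith, by linarith, by linarith,
      by linarith, ?_⟩
    simp only [rowMap, rowSign, if_true, he0, h3]
    module
  · refine ⟨(a + 1) / 2, b / 2, c / 2, by linarith, by linarith, by linarith, by linarith, ?_⟩
    simp [rowMap, rowSign]
    module
  · refine ⟨a / 2, (b + 1) / 2, c / 2, by linarith, by linarith, by linarith, by linarith, ?_⟩
    simp [rowMap, rowSign]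
    module
  · refine ⟨a / 2, b / 2, (c + 1) / 2, by linarith, by linarith, by linarith, by linarith, ?_⟩
    simp [rowMap, rowSign]
    module

lemma iterMap_mem (e : F2 × F2 → Pt) (he0 : e (0, 0) = 0)
    (hsum : e (1, 0) + e (0, 1) + e (1, 1) = 0) (l : List (F2 × F2)) {z : Pt}
    (hz : z ∈ baseTri e) : iterMap e l z ∈ baseTri e := by
  induction l with
  | nil => exact hz
  | cons ξ l ih => exact rowMap_mem e he0 hsum ξ ih

lemma subTri_eq_image (e : F2 × F2 → Pt) (he0 : e (0, 0) = 0)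
    (hsum : e (1, 0) + e (0, 1) + e (1, 1) = 0) (l : List (F2 × F2)) :
    subTri (e (1, 0), e (0, 1), e (1, 1)) l = iterMap e l '' baseTri e := by
  rw [subTri, vIter_base e he0 hsum]
  obtain ⟨r, c, -, h⟩ := iterMap_eq e l
  have key : ∀ a b d : ℝ, a + b + d = 1 →
      a • (r • e (1, 0) + c) + b • (r • e (0, 1) + c) + d • (r • e (1, 1) + c) =
        r • (a • e (1, 0) + b • e (0, 1) + d • e (1, 1)) + c := by
    intro a b d habd
    obtain rfl : d = 1 - a - b := by linarith
    module
  ext x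
  constructor
  · rintro ⟨a, b, d, ha, hb, hd, hs, rfl⟩
    refine ⟨_, ⟨a, b, d, ha, hb, hd, hs, rfl⟩, ?_⟩
    simp only [h]
    exact (key a b d hs).symm
  · rintro ⟨_, ⟨a, b, d, ha, hb, hd, hs, rfl⟩, rfl⟩
    refine ⟨a, b, d, ha, hb, hd, hs, ?_⟩
    simp only [h]
    exact (key a b d hs).symm

lemma setIntegral_image_smul_add {r : ℝ} (hr : r ≠ 0) (c : Pt) {S : Set Pt}
    (hS : MeasurableSet S) (f : Pt → ℝ) :
    ∫ y in (fun z => r • z + c) '' S, f y = |r| ^ 2 * ∫ z in S, f (r • z + c) := by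
  have hd : ∀ x ∈ S, HasFDerivWithinAt (fun z : Pt => r • z + c)
      (r • ContinuousLinearMap.id ℝ Pt) S x := fun x _ =>
    (((hasFDerivAt_id x).const_smul r).add_const c).hasFDerivWithinAt
  rw [integral_image_eq_integral_abs_det_fderiv_smul volume hS hd
    (fun x _ y _ hxy => smul_right_injective Pt hr (add_right_cancel hxy))]
  simp [ContinuousLinearMap.det, LinearMap.det_smul, integral_const_mul]

lemma discF_eq (e : F2 × F2 → Pt) (he0 : e (0, 0) = 0)
    (hsum : e (1, 0) + e (0, 1) + e (1, 1) = 0) {n : ℕ} (f : Pt → ℝ) (X : Fin n → F2 × F2) :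
    discF (e (1, 0), e (0, 1), e (1, 1)) f X =
      (volume (baseTri e)).toReal⁻¹ * ∫ z in baseTri e, f (iterMap e (List.ofFn X) z) := by
  obtain ⟨r, c, hr, h⟩ := iterMap_eq e (List.ofFn X)
  have hr0 : |r| ≠ 0 := by rw [hr]; positivity
  have hm : MeasurableSet (baseTri e) := (isCompact_baseTri e).measurableSet
  have hI : iterMap e (List.ofFn X) = fun z => r • z + c := funext h
  have hv := setIntegral_image_smul_add (abs_ne_zero.1 hr0) c hm (fun _ => 1)
  simp only [setIntegral_const, smul_eq_mul, mul_one, Measure.real] at hv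
  rw [discF, subTri_eq_image e he0 hsum, hI, setIntegral_image_smul_add (abs_ne_zero.1 hr0) c hm,
    hv]
  field_simp

lemma abs_le_supAbs {T : Set Pt} (hT : IsCompact T) {g : Pt → ℝ} (hg : ContinuousOn g T)
    {x : Pt} (hx : x ∈ T) : |g x| ≤ supAbs T g := by
  obtain ⟨B, hB⟩ := (hT.bddAbove_image hg.abs)
  have hB' : ∀ y ∈ T, |g y| ≤ B := fun y hy => hB ⟨y, hy, rfl⟩
  have hB0 : 0 ≤ B := (abs_nonneg _).trans (hB' x hx)
  have hbdd : BddAbove (Set.range fun y => ⨆ _ : y ∈ T, |g y|) := by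
    refine ⟨B, ?_⟩
    rintro _ ⟨y, rfl⟩
    exact Real.iSup_le (fun hy => hB' y hy) hB0
  refine le_trans ?_ (le_ciSup hbdd x)
  simp [hx]

lemma eq_dir_add_dir (v : Pt) : v = v 0 • dir1 + v 1 • dir2 := by
  ext i
  fin_cases i <;> simp [dir1, dir2]

lemma abs_coord_add_le (v : Pt) : |v 0| + |v 1| ≤ √2 * ‖v‖ := by
  rw [EuclideanSpace.norm_eq, ← Real.sqrt_mul (by norm_num)]
  apply Real.le_sqrt_of_sq_le
  simp only [Fin.sum_univ_two, Real.norm_eq_abs]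
  nlinarith [sq_nonneg (|v 0| - |v 1|)]

lemma norm_le_of_dir_le {E : Type*} [NormedAddCommGroup E] [NormedSpace ℝ E] {L : Pt →L[ℝ] E}
    {M : ℝ} (hM : 0 ≤ M) (h1 : ‖L dir1‖ ≤ M) (h2 : ‖L dir2‖ ≤ M) : ‖L‖ ≤ √2 * M := by
  refine L.opNorm_le_bound (by positivity) fun v => ?_
  calc ‖L v‖ = ‖v 0 • L dir1 + v 1 • L dir2‖ := by
        conv_lhs => rw [eq_dir_add_dir v]
        simp
    _ ≤ |v 0| * M + |v 1| * M := by
        refine (norm_add_le _ _).trans ?_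
        rw [norm_smul, norm_smul, Real.norm_eq_abs, Real.norm_eq_abs]
        gcongr
    _ = (|v 0| + |v 1|) * M := by ring
    _ ≤ (√2 * ‖v‖) * M := by gcongr; exact abs_coord_add_le v
    _ = √2 * M * ‖v‖ := by ring

section Calculus

variable {T : Set Pt} {f : Pt → ℝ}

lemma pdW_pdW_eq (hT : UniqueDiffOn ℝ T) (hf : ContDiffOn ℝ 2 f T) (u v : Pt) {x : Pt}
    (hx : x ∈ T) :
    pdW T u (pdW T v f) x = fderivWithin ℝ (fderivWithin ℝ f T) T x u v := by
  have hD : DifferentiableWithinAt ℝ (fderivWithin ℝ f T) T x :=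
    (hf.fderivWithin hT (m := 1) (by norm_num)).differentiableOn (by norm_num) x hx
  have h := hD.hasFDerivWithinAt.clm_apply (hasFDerivWithinAt_const v x T)
  rw [pdW, show pdW T v f = fun y => fderivWithin ℝ f T y v from rfl, h.fderivWithin (hT x hx)]
  simp

lemma continuousOn_pdW (hT : UniqueDiffOn ℝ T) (hf : ContDiffOn ℝ 2 f T) (v : Pt) :
    ContinuousOn (pdW T v f) T :=
  (hf.continuousOn_fderivWithin hT (by norm_num)).clm_apply continuousOn_const

lemma continuousOn_pdW_pdW (hT : UniqueDiffOn ℝ T) (hf : ContDiffOn ℝ 2 f T) (u v : Pt) :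
    ContinuousOn (pdW T u (pdW T v f)) T := by
  have h1 : ContDiffOn ℝ 1 (pdW T v f) T :=
    (hf.fderivWithin hT (m := 1) (by norm_num)).clm_apply contDiffOn_const
  exact (h1.continuousOn_fderivWithin hT (by norm_num)).clm_apply continuousOn_const

lemma c2Norm_nonneg (hTc : IsCompact T) (hTne : T.Nonempty) (hf : ContDiffOn ℝ 2 f T) :
    0 ≤ c2Norm T f := by
  obtain ⟨x, hx⟩ := hTne
  exact (abs_nonneg _).trans ((abs_le_supAbs hTc hf.continuousOn hx).trans (le_max_left _ _))

lemma norm_fderivWithin_le_c2Norm (hTc : IsCompact T) (hT : UniqueDiffOn ℝ T)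
    (hf : ContDiffOn ℝ 2 f T) {x : Pt} (hx : x ∈ T) :
    ‖fderivWithin ℝ f T x‖ ≤ √2 * c2Norm T f := by
  refine norm_le_of_dir_le (c2Norm_nonneg hTc ⟨x, hx⟩ hf) ?_ ?_
  · refine (abs_le_supAbs hTc (continuousOn_pdW hT hf dir1) hx).trans ?_
    simp [c2Norm]
  · refine (abs_le_supAbs hTc (continuousOn_pdW hT hf dir2) hx).trans ?_
    simp [c2Norm]

lemma norm_fderivWithin_fderivWithin_le_c2Norm (hTc : IsCompact T) (hTconv : Convex ℝ T)
    (hTi : (interior T).Nonempty) (hf : ContDiffOn ℝ 2 f T) {x : Pt} (hx : x ∈ T) :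
    ‖fderivWithin ℝ (fderivWithin ℝ f T) T x‖ ≤ 2 * c2Norm T f := by
  have hT : UniqueDiffOn ℝ T := uniqueDiffOn_convex hTconv hTi
  have hM := c2Norm_nonneg hTc ⟨x, hx⟩ hf
  have hb : ∀ u v : Pt, supAbs T (pdW T u (pdW T v f)) ≤ c2Norm T f →
      ‖fderivWithin ℝ (fderivWithin ℝ f T) T x u v‖ ≤ c2Norm T f := fun u v h => by
    rw [← pdW_pdW_eq hT hf u v hx]
    exact (abs_le_supAbs hTc (continuousOn_pdW_pdW hT hf u v) hx).trans h
  have h11 := hb dir1 dir1 (by simp [c2Norm])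
  have h21 := hb dir2 dir1 (by simp [c2Norm])
  have h22 := hb dir2 dir2 (by simp [c2Norm])
  have hsymm : IsSymmSndFDerivWithinAt ℝ f T x := by
    refine (hf x hx).isSymmSndFDerivWithinAt (by simp) hT ?_ hx
    rw [hTconv.closure_interior_eq_closure_of_nonempty_interior hTi]
    exact subset_closure hx
  have h12 : ‖fderivWithin ℝ (fderivWithin ℝ f T) T x dir1 dir2‖ ≤ c2Norm T f := by
    rwa [hsymm.eq]
  have h := norm_le_of_dir_le (by positivity) (norm_le_of_dir_le hM h11 h12)
    (norm_le_of_dir_le hM h21 h22)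
  rwa [← mul_assoc, Real.mul_self_sqrt (by norm_num)] at h

/-- First-order difference estimate. -/
lemma abs_sub_le_c2Norm (hTc : IsCompact T) (hTconv : Convex ℝ T)
    (hTi : (interior T).Nonempty) (hf : ContDiffOn ℝ 2 f T) {x y : Pt} (hx : x ∈ T) (hy : y ∈ T) :
    |f x - f y| ≤ √2 * c2Norm T f * ‖x - y‖ :=
  hTconv.norm_image_sub_le_of_norm_fderivWithin_le (hf.differentiableOn (by norm_num))
    (fun _ hz => norm_fderivWithin_le_c2Norm hTc (uniqueDiffOn_convex hTconv hTi) hf hz) hy hx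

/-- Second-order difference estimate over a parallelogram. -/
lemma abs_parallelogram_le_c2Norm (hTc : IsCompact T) (hTconv : Convex ℝ T)
    (hTi : (interior T).Nonempty) (hf : ContDiffOn ℝ 2 f T) {x y x' y' : Pt} (hx : x ∈ T)
    (hy : y ∈ T) (hx' : x' ∈ T) (hy' : y' ∈ T) (h : y - x = y' - x') :
    |f y - f x - (f y' - f x')| ≤ 2 * c2Norm T f * ‖x - x'‖ * ‖y - x‖ := by
  have hT : UniqueDiffOn ℝ T := uniqueDiffOn_convex hTconv hTi
  have hline : ∀ {a b : Pt}, a ∈ T → b ∈ T → ∀ t ∈ Set.Icc (0:ℝ) 1, a + t • (b - a) ∈ T :=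
    fun ha hb t ht => hTconv.add_smul_sub_mem ha hb ht
  have hderiv : ∀ {a b : Pt}, a ∈ T → b ∈ T → ∀ t ∈ Set.Icc (0:ℝ) 1,
      HasDerivWithinAt (fun t : ℝ => f (a + t • (b - a)))
        (fderivWithin ℝ f T (a + t • (b - a)) (b - a)) (Set.Icc 0 1) t := by
    intro a b ha hb t ht
    have h1 : HasDerivWithinAt (fun t : ℝ => a + t • (b - a)) (b - a) (Set.Icc 0 1) t := by
      simpa using (((hasDerivAt_id t).smul_const (b - a)).const_add a).hasDerivWithinAt
    have h2 := (hf.differentiableOn (by norm_num) _ (hline ha hb t ht)).hasFDerivWithinAt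
    exact h2.comp_hasDerivWithinAt t h1 (fun s hs => hline ha hb s hs)
  have key := norm_image_sub_le_of_norm_deriv_le_segment_01'
    (f := fun t : ℝ => f (x + t • (y - x)) - f (x' + t • (y' - x')))
    (C := 2 * c2Norm T f * ‖x - x'‖ * ‖y - x‖)
    (fun t ht => (hderiv hx hy t ht).sub (hderiv hx' hy' t ht)) (fun t ht => ?_)
  · simp only [one_smul, zero_smul, add_zero, add_sub_cancel] at key
    rw [Real.norm_eq_abs] at key
    convert key using 2
    ring
  · have ht' : t ∈ Set.Icc (0:ℝ) 1 := ⟨ht.1, ht.2.le⟩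
    rw [← h, ← sub_apply]
    refine (ContinuousLinearMap.le_opNorm _ _).trans ?_
    gcongr
    have h1 := hTconv.norm_image_sub_le_of_norm_fderivWithin_le
      ((hf.fderivWithin hT (m := 1) (by norm_num)).differentiableOn (by norm_num))
      (fun _ hz => norm_fderivWithin_fderivWithin_le_c2Norm hTc hTconv hTi hf hz)
      (hline hx' hy' t ht') (hline hx hy t ht')
    rwa [← h, add_sub_add_right_eq_sub] at h1

end Calculus

lemma neg_one_pow_val_add (a b : F2) : (-1 : ℝ) ^ (a + b).val = (-1) ^ a.val * (-1) ^ b.val := by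
  rw [ZMod.val_add, ← pow_add, ← neg_one_pow_eq_pow_mod_two]

/-- Translation of row `i` of `X` by `s`. -/
def shiftRow {n : ℕ} (i : Fin n) (s : F2 × F2) (X : Fin n → F2 × F2) : Fin n → F2 × F2 :=
  Function.update X i (X i + s)

lemma shiftRow_same {n : ℕ} (i : Fin n) (s : F2 × F2) (X : Fin n → F2 × F2) :
    shiftRow i s X i = X i + s := by simp [shiftRow]

lemma shiftRow_of_ne {n : ℕ} {i k : Fin n} (h : k ≠ i) (s : F2 × F2) (X : Fin n → F2 × F2) :
    shiftRow i s X k = X k := by simp [shiftRow, h]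

lemma row_add_self (s : F2 × F2) : s + s = 0 := by
  revert s; decide

lemma shiftRow_shiftRow {n : ℕ} (i : Fin n) (s : F2 × F2) (X : Fin n → F2 × F2) :
    shiftRow i s (shiftRow i s X) = X := by
  simp [shiftRow, add_assoc, row_add_self]

lemma walR_shiftRow {n : ℕ} (K X : Fin n → F2 × F2) (i : Fin n) (s : F2 × F2) :
    walR K (shiftRow i s X) = walRow (K i) s * walR K X := by
  rw [walR, walRow, walR, ← neg_one_pow_val_add]
  congr 2
  have h : ∀ k, (K k).1 * (shiftRow i s X k).1 + (K k).2 * (shiftRow i s X k).2 =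
      (if k = i then (K i).1 * s.1 + (K i).2 * s.2 else 0) +
        ((K k).1 * (X k).1 + (K k).2 * (X k).2) := by
    intro k
    rcases eq_or_ne k i with rfl | hk
    · simp only [shiftRow_same, if_true, Prod.fst_add, Prod.snd_add]; ring
    · simp [shiftRow_of_ne hk, hk]
  simp_rw [h, Finset.sum_add_distrib, Finset.sum_ite_eq' Finset.univ i, Finset.mem_univ, if_true]

lemma abs_walR {n : ℕ} (K X : Fin n → F2 × F2) : |walR K X| = 1 := by
  simp [walR, abs_pow]

/-- Symmetrization of a Walsh sum over a set invariant under a row translation. -/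
lemma sum_mul_walR_eq_half {n : ℕ} (K : Fin n → F2 × F2) (i : Fin n) (s : F2 × F2)
    {S : Finset (Fin n → F2 × F2)} (hS : ∀ X ∈ S, shiftRow i s X ∈ S)
    (G : (Fin n → F2 × F2) → ℝ) :
    ∑ X ∈ S, G X * walR K X =
      2⁻¹ * ∑ X ∈ S, (G X + walRow (K i) s * G (shiftRow i s X)) * walR K X := by
  have h : ∑ X ∈ S, G X * walR K X =
      ∑ X ∈ S, walRow (K i) s * G (shiftRow i s X) * walR K X := by
    refine Finset.sum_nbij' (shiftRow i s) (shiftRow i s) hS hS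
      (fun X _ => shiftRow_shiftRow i s X) (fun X _ => shiftRow_shiftRow i s X) fun X _ => ?_
    rw [shiftRow_shiftRow, walR_shiftRow]
    have h1 : walRow (K i) s * walRow (K i) s = 1 := by
      rw [walRow, ← pow_add, Even.neg_one_pow ⟨_, rfl⟩]
    linear_combination (-(G X * walR K X)) * h1
  simp_rw [add_mul, Finset.sum_add_distrib]
  rw [← h]
  ring

lemma abs_sum_mul_walR_le {n : ℕ} (K : Fin n → F2 × F2) {S : Finset (Fin n → F2 × F2)}
    {G : (Fin n → F2 × F2) → ℝ} {δ : ℝ} (hG : ∀ X ∈ S, |G X| ≤ δ) :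
    |∑ X ∈ S, G X * walR K X| ≤ S.card * δ := by
  refine (Finset.abs_sum_le_sum_abs _ _).trans ?_
  rw [← nsmul_eq_mul]
  refine Finset.sum_le_card_nsmul _ _ _ fun X hX => ?_
  rw [abs_mul, abs_walR, mul_one]
  exact hG X hX

lemma vK_le {n : ℕ} (K : Fin n → F2 × F2) : vK K ≤ n :=
  max_le (Finset.sup_le fun i _ => i.2) (Finset.sup_le fun i _ => i.2)

lemma exists_mu1_eq {n : ℕ} {k : Fin n → F2} (h : 1 ≤ mu1 k) :
    ∃ i : Fin n, k i ≠ 0 ∧ (i : ℕ) + 1 = mu1 k := by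
  have hne : (Finset.univ.filter fun i : Fin n => k i ≠ 0).Nonempty := by
    rw [Finset.nonempty_iff_ne_empty]
    intro h0
    simp [mu1, h0] at h
  obtain ⟨i, hi, h2⟩ := Finset.exists_mem_eq_sup _ hne fun i : Fin n => (i : ℕ) + 1
  exact ⟨i, (Finset.mem_filter.1 hi).2, h2.symm⟩

lemma exists_vK_eq {n : ℕ} {K : Fin n → F2 × F2} (h : 1 ≤ vK K) :
    ∃ i : Fin n, K i ≠ (0, 0) ∧ (i : ℕ) + 1 = vK K := by
  rcases le_total (mu1 fun i => (K i).1) (mu1 fun i => (K i).2) with h1 | h1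
  · rw [vK, max_eq_right h1] at h ⊢
    obtain ⟨i, hi, h2⟩ := exists_mu1_eq h
    exact ⟨i, fun h0 => hi (by rw [h0]), h2⟩
  · rw [vK, max_eq_left h1] at h ⊢
    obtain ⟨i, hi, h2⟩ := exists_mu1_eq h
    exact ⟨i, fun h0 => hi (by rw [h0]), h2⟩

lemma walRow_sigF_of_ne {κ : F2 × F2} (h : κ ≠ (0, 0)) : walRow κ (sigF κ) = -1 := by
  have h1 : ∀ κ : F2 × F2, κ ≠ (0, 0) → κ.1 * (sigF κ).1 + κ.2 * (sigF κ).2 = 1 := by decide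
  rw [walRow, h1 κ h, ZMod.val_one, pow_one]

lemma walRow_zero (s : F2 × F2) : walRow (0, 0) s = 1 := by simp [walRow]

lemma add_sigF_mem_pSet : ∀ κ ξ : F2 × F2, ξ ∈ pSet κ → ξ + sigF κ ∈ pSet κ := by decide

lemma rowSign_add_sigF {κ ξ : F2 × F2} (h : ξ ∈ pSet κ) :
    (walRow κ (sigF κ) = -1 ∧ rowSign (ξ + sigF κ) = rowSign ξ) ∨
      (walRow κ (sigF κ) = 1 ∧ rowSign (ξ + sigF κ) = -rowSign ξ) := by
  have key : ∀ κ ξ : F2 × F2, ξ ∈ pSet κ →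
      (κ ≠ (0, 0) ∧ ξ ≠ (0, 0) ∧ ξ + sigF κ ≠ (0, 0)) ∨
        (κ = (0, 0) ∧ ((ξ = (0, 0) ∧ ξ + sigF κ ≠ (0, 0)) ∨
          (ξ ≠ (0, 0) ∧ ξ + sigF κ = (0, 0)))) := by decide
  rcases key κ ξ h with ⟨h1, h2, h3⟩ | ⟨rfl, ⟨h2, h3⟩ | ⟨h2, h3⟩⟩
  · exact Or.inl ⟨walRow_sigF_of_ne h1, by rw [rowSign, rowSign, if_neg h2, if_neg h3]⟩
  · exact Or.inr ⟨walRow_zero _, by rw [rowSign, rowSign, if_pos h2, if_neg h3, neg_neg]⟩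
  · exact Or.inr ⟨walRow_zero _, by rw [rowSign, rowSign, if_neg h2, if_pos h3]⟩

lemma mem_Rset {n : ℕ} {K X : Fin n → F2 × F2} {w : ℕ} :
    X ∈ Rset K w ↔ (∀ i : Fin n, w ≤ (i : ℕ) → (i : ℕ) + 1 < vK K → X i ∉ pSet (K i)) ∧
      (w = 0 ∨ ∃ j : Fin n, (j : ℕ) + 1 = w ∧ X j ∈ pSet (K j)) := by
  simp [Rset]

lemma shiftRow_last_mem_Rset {n : ℕ} {K X : Fin n → F2 × F2} {w : ℕ} {i : Fin n}
    (hi : (i : ℕ) + 1 = vK K) (hw : w < vK K) (s : F2 × F2) (hX : X ∈ Rset K w) :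
    shiftRow i s X ∈ Rset K w := by
  rw [mem_Rset] at hX ⊢
  refine ⟨fun k h1 h2 => ?_, hX.2.imp_right ?_⟩
  · rw [shiftRow_of_ne (by rintro rfl; omega)]
    exact hX.1 k h1 h2
  · rintro ⟨j, hj, h⟩
    exact ⟨j, hj, by rwa [shiftRow_of_ne (by rintro rfl; omega)]⟩

lemma shiftRow_sigF_mem_Rset {n : ℕ} {K X : Fin n → F2 × F2} {w : ℕ} {j : Fin n}
    (hj : (j : ℕ) + 1 = w) (hX : X ∈ Rset K w) :
    shiftRow j (sigF (K j)) X ∈ Rset K w := by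
  rw [mem_Rset] at hX ⊢
  refine ⟨fun k h1 h2 => ?_, Or.inr ⟨j, hj, ?_⟩⟩
  · rw [shiftRow_of_ne (by rintro rfl; omega)]
    exact hX.1 k h1 h2
  · rcases hX.2 with h | ⟨k, hk, h⟩
    · omega
    · obtain rfl : k = j := Fin.ext (by omega)
      rw [shiftRow_same]
      exact add_sigF_mem_pSet _ _ h

lemma card_Rset_mul_le {n : ℕ} (K : Fin n → F2 × F2) (w : ℕ) :
    (Rset K w).card * 2 ^ (vK K - max w 1) ≤ 4 ^ n := by
  set c : Fin n → Prop := fun i => w ≤ (i : ℕ) + 1 ∧ (i : ℕ) + 1 < vK K with hc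
  set A : Fin n → Finset (F2 × F2) := fun i =>
    if c i then (if (i : ℕ) + 1 = w then pSet (K i) else (pSet (K i))ᶜ) else Finset.univ with hA
  have hsub : Rset K w ⊆ Fintype.piFinset A := by
    intro X hX
    rw [mem_Rset] at hX
    rw [Fintype.mem_piFinset]
    intro i
    by_cases h : c i
    · by_cases h' : (i : ℕ) + 1 = w
      · simp only [hA, if_pos h, if_pos h']
        rcases hX.2 with h0 | ⟨k, hk, h0⟩
        · omega
        · obtain rfl : k = i := Fin.ext (by omega)
          exact h0
      · simp only [hA, if_pos h, if_neg h', Finset.mem_compl]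
        exact hX.1 i (by have := h.1; omega) h.2
    · simp [hA, h]
  have hcard : ∀ i, (A i).card = if c i then 2 else 4 := by
    have h1 : ∀ κ : F2 × F2, (pSet κ).card = 2 ∧ ((pSet κ)ᶜ).card = 2 := by decide
    intro i
    simp only [hA]
    split_ifs
    · exact (h1 _).1
    · exact (h1 _).2
    · rfl
  have hfil : vK K - max w 1 ≤ (Finset.univ.filter c).card := by
    rw [← Nat.card_Ico]
    refine Finset.card_le_card_of_surjOn (fun i : Fin n => (i : ℕ) + 1) ?_
    intro m hm
    simp only [Finset.coe_Ico, Set.mem_Ico] at hm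
    have := vK_le K
    refine ⟨⟨m - 1, by omega⟩, ?_, ?_⟩
    · simp only [hc, Finset.coe_filter, Finset.mem_univ, true_and, Set.mem_ofPred_eq]
      omega
    · simp only; omega
  calc (Rset K w).card * 2 ^ (vK K - max w 1)
      ≤ (∏ i, (A i).card) * 2 ^ (Finset.univ.filter c).card := by
        rw [← Fintype.card_piFinset]
        exact Nat.mul_le_mul (Finset.card_le_card hsub) (Nat.pow_le_pow_right (by norm_num) hfil)
    _ = ∏ i : Fin n, (if c i then 2 else 4) * (if c i then 2 else 1) := by
        rw [Finset.prod_mul_distrib, ← Finset.prod_filter, Finset.prod_const]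
        simp_rw [hcard]
    _ = 4 ^ n := by
        have : ∀ i : Fin n, (if c i then 2 else 4) * (if c i then 2 else 1) = 4 := by
          intro i; split_ifs <;> norm_num
        simp_rw [this, Finset.prod_const, Finset.card_univ, Fintype.card_fin]

/-- The Walsh coefficient splits over the sets `R_w(K)`. -/
lemma fhat_eq_sum_rwHat {n : ℕ} {K : Fin n → F2 × F2} (hK : 1 ≤ vK K)
    (F : (Fin n → F2 × F2) → ℝ) :
    fhat F K = ∑ w ∈ Finset.range (vK K), rwHat F K w := by
  classical
  set B : (Fin n → F2 × F2) → Finset (Fin n) := fun X =>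
    Finset.univ.filter fun i : Fin n => (i : ℕ) + 1 < vK K ∧ X i ∈ pSet (K i) with hB
  set g : (Fin n → F2 × F2) → ℕ := fun X => (B X).sup fun i => (i : ℕ) + 1 with hg
  have hlt : ∀ X, g X < vK K := fun X => by
    rw [hg, Finset.sup_lt_iff (by simpa using Nat.lt_of_lt_of_le Nat.zero_lt_one hK)]
    intro i hi
    exact (Finset.mem_filter.1 hi).2.1
  have hle : ∀ X i, i ∈ B X → (i : ℕ) + 1 ≤ g X := fun X i hi =>
    Finset.le_sup (f := fun i : Fin n => (i : ℕ) + 1) hi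
  have hfib : ∀ w ∈ Finset.range (vK K), Rset K w = Finset.univ.filter fun X => g X = w := by
    intro w hw
    rw [Finset.mem_range] at hw
    ext X
    simp only [mem_Rset, Finset.mem_filter, Finset.mem_univ, true_and]
    constructor
    · rintro ⟨h1, h2⟩
      apply le_antisymm
      · refine Finset.sup_le fun i hi => ?_
        by_contra hcon
        have hi' := (Finset.mem_filter.1 hi).2
        exact h1 i (by omega) hi'.1 hi'.2
      · rcases h2 with rfl | ⟨j, hj, h⟩
        · exact Nat.zero_le _
        · rw [← hj]
          exact hle X j (by simp only [hB, Finset.mem_filter, Finset.mem_univ, true_and]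
                            exact ⟨by omega, h⟩)
    · rintro rfl
      refine ⟨fun i h1 h2 h3 => ?_, ?_⟩
      · have := hle X i (by simp only [hB, Finset.mem_filter, Finset.mem_univ, true_and]
                            exact ⟨h2, h3⟩)
        omega
      · rcases (B X).eq_empty_or_nonempty with h | h
        · left; simp [hg, h]
        · right
          obtain ⟨j, hj, h2⟩ := Finset.exists_mem_eq_sup _ h fun i : Fin n => (i : ℕ) + 1
          exact ⟨j, h2.symm, (Finset.mem_filter.1 hj).2.2⟩
  simp_rw [rwHat, ← Finset.mul_sum]
  rw [fhat, ← Finset.sum_fiberwise_of_maps_to fun X _ => Finset.mem_range.2 (hlt X)]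
  congr 1
  exact Finset.sum_congr rfl fun w hw => by rw [hfib w hw]

lemma ofFn_update {n : ℕ} (X : Fin n → F2 × F2) (i : Fin n) (a : F2 × F2) :
    List.ofFn (Function.update X i a) = (List.ofFn X).set i a := by
  refine List.ext_getElem (by simp) fun k h1 h2 => ?_
  simp only [List.getElem_ofFn, List.getElem_set, Function.update_apply, Fin.ext_iff,
    eq_comm (a := k)]

lemma iterMap_append (e : F2 × F2 → Pt) (l l' : List (F2 × F2)) (z : Pt) :
    iterMap e (l ++ l') z = iterMap e l (iterMap e l' z) :=
  List.foldr_append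

lemma iterMap_cons (e : F2 × F2 → Pt) (ξ : F2 × F2) (l : List (F2 × F2)) (z : Pt) :
    iterMap e (ξ :: l) z = rowMap e ξ (iterMap e l z) := rfl

lemma iterMap_ofFn_split (e : F2 × F2 → Pt) {n : ℕ} (X : Fin n → F2 × F2) (j : Fin n) (z : Pt) :
    iterMap e (List.ofFn X) z = iterMap e ((List.ofFn X).take j)
      (rowMap e (X j) (iterMap e ((List.ofFn X).drop (j + 1)) z)) := by
  have h : List.ofFn X = (List.ofFn X).take j ++ X j :: (List.ofFn X).drop (j + 1) := by
    conv_lhs => rw [← List.take_append_drop j (List.ofFn X),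
      List.drop_eq_getElem_cons (i := j) (by simp)]
    simp
  conv_lhs => rw [h, iterMap_append, iterMap_cons]

lemma take_ofFn_shiftRow {n : ℕ} (X : Fin n → F2 × F2) {i : Fin n} {k : ℕ} (h : k ≤ i)
    (s : F2 × F2) : (List.ofFn (shiftRow i s X)).take k = (List.ofFn X).take k := by
  rw [shiftRow, ofFn_update, List.take_set_of_le h]

lemma drop_ofFn_shiftRow {n : ℕ} (X : Fin n → F2 × F2) {i : Fin n} {k : ℕ} (h : (i : ℕ) < k)
    (s : F2 × F2) : (List.ofFn (shiftRow i s X)).drop k = (List.ofFn X).drop k := by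
  rw [shiftRow, ofFn_update, List.drop_set_of_lt h]

section Differences

variable {e : F2 × F2 → Pt} (he0 : e (0, 0) = 0) (hsum : e (1, 0) + e (0, 1) + e (1, 1) = 0)

include he0 hsum

/-- Points of subtriangles with a common prefix of length `k` are close to each other. -/
lemma norm_iterMap_sub_le {n : ℕ} {X Y : Fin n → F2 × F2} {k : ℕ} (hk : k ≤ n)
    (h : (List.ofFn X).take k = (List.ofFn Y).take k) {z : Pt} (hz : z ∈ baseTri e) :
    ‖iterMap e (List.ofFn X) z - iterMap e (List.ofFn Y) z‖ ≤
      (2 ^ k)⁻¹ * Metric.diam (baseTri e) := by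
  rw [← List.take_append_drop k (List.ofFn X), ← List.take_append_drop k (List.ofFn Y), ← h,
    iterMap_append, iterMap_append, norm_iterMap_sub, ← dist_eq_norm]
  have hlen : ((List.ofFn X).take k).length = k := by simp [hk]
  rw [hlen]
  gcongr
  exact Metric.dist_le_diam_of_mem (isCompact_baseTri e).isBounded
    (iterMap_mem e he0 hsum _ hz) (iterMap_mem e he0 hsum _ hz)

variable (hT : AffineIndependent ℝ ![e (1, 0), e (0, 1), e (1, 1)])
  {f : Pt → ℝ} (hf : ContDiffOn ℝ 2 f (baseTri e))

include hT hf

lemma abs_shiftRow_difference_le {n : ℕ} (X : Fin n → F2 × F2) (i : Fin n) (s : F2 × F2) {z : Pt}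
    (hz : z ∈ baseTri e) :
    |f (iterMap e (List.ofFn X) z) - f (iterMap e (List.ofFn (shiftRow i s X)) z)| ≤
      √2 * c2Norm (baseTri e) f * ((2 ^ (i : ℕ))⁻¹ * Metric.diam (baseTri e)) := by
  refine (abs_sub_le_c2Norm (isCompact_baseTri e) (convex_baseTri e)
    (interior_baseTri_nonempty hT) hf (iterMap_mem e he0 hsum _ hz) (iterMap_mem e he0 hsum _ hz)).trans ?_
  have hM := c2Norm_nonneg (isCompact_baseTri e) ⟨z, hz⟩ hf
  gcongr
  exact norm_iterMap_sub_le he0 hsum i.2.le (take_ofFn_shiftRow X le_rfl s).symm hz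

lemma abs_shiftRow_second_difference_le {n : ℕ} {K X : Fin n → F2 × F2} {i j : Fin n}
    (hji : j < i) (hX : X j ∈ pSet (K j)) (s : F2 × F2) {z : Pt} (hz : z ∈ baseTri e) :
    |f (iterMap e (List.ofFn X) z) - f (iterMap e (List.ofFn (shiftRow i s X)) z) +
      walRow (K j) (sigF (K j)) * (f (iterMap e (List.ofFn (shiftRow j (sigF (K j)) X)) z) -
        f (iterMap e (List.ofFn (shiftRow i s (shiftRow j (sigF (K j)) X))) z))| ≤
      2 * c2Norm (baseTri e) f * ((2 ^ (j : ℕ))⁻¹ * Metric.diam (baseTri e)) *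
        ((2 ^ (i : ℕ))⁻¹ * Metric.diam (baseTri e)) := by
  have hji' : (j : ℕ) < i := hji
  have hne : j ≠ i := hji.ne
  have hM := c2Norm_nonneg (isCompact_baseTri e) ⟨z, hz⟩ hf
  set t := sigF (K j)
  set Y := shiftRow j t X
  have hmem : ∀ Z : Fin n → F2 × F2, iterMap e (List.ofFn Z) z ∈ baseTri e := fun Z =>
    iterMap_mem e he0 hsum _ hz
  have hp1 : (List.ofFn (shiftRow i s X)).take j = (List.ofFn X).take j :=
    take_ofFn_shiftRow X hji'.le s
  have hp2 : (List.ofFn Y).take j = (List.ofFn X).take j := take_ofFn_shiftRow X le_rfl t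
  have hp3 : (List.ofFn (shiftRow i s Y)).take j = (List.ofFn X).take j :=
    (take_ofFn_shiftRow Y hji'.le s).trans hp2
  have hq2 : (List.ofFn Y).drop (j + 1) = (List.ofFn X).drop (j + 1) :=
    drop_ofFn_shiftRow X (Nat.lt_succ_self _) t
  have hcomm : shiftRow i s Y = shiftRow j t (shiftRow i s X) := by
    funext k
    rcases eq_or_ne k i with rfl | hk
    · simp [Y, shiftRow_same, shiftRow_of_ne hne.symm]
    · rcases eq_or_ne k j with rfl | hk'
      · simp [Y, shiftRow_same, shiftRow_of_ne hne]
      · simp [Y, shiftRow_of_ne hk, shiftRow_of_ne hk']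
  have hq3 : (List.ofFn (shiftRow i s Y)).drop (j + 1) =
      (List.ofFn (shiftRow i s X)).drop (j + 1) := by
    rw [hcomm]; exact drop_ofFn_shiftRow _ (Nat.lt_succ_self _) t
  obtain ⟨r, c, -, hr⟩ := iterMap_eq e ((List.ofFn X).take j)
  have e0 := iterMap_ofFn_split e X j z
  have e1 := iterMap_ofFn_split e (shiftRow i s X) j z
  have e2 := iterMap_ofFn_split e Y j z
  have e3 := iterMap_ofFn_split e (shiftRow i s Y) j z
  rw [hp1, shiftRow_of_ne hne] at e1
  rw [hp2, hq2, show Y j = X j + t from shiftRow_same j t X] at e2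
  rw [hp3, hq3, shiftRow_of_ne hne, show Y j = X j + t from shiftRow_same j t X] at e3
  simp only [hr, rowMap] at e0 e1 e2 e3
  have hclose : ‖iterMap e (List.ofFn X) z - iterMap e (List.ofFn (shiftRow i s X)) z‖ ≤
      (2 ^ (i : ℕ))⁻¹ * Metric.diam (baseTri e) :=
    norm_iterMap_sub_le he0 hsum i.2.le (take_ofFn_shiftRow X le_rfl s).symm hz
  rcases rowSign_add_sigF hX with ⟨hw, hs⟩ | ⟨hw, hs⟩
  · have h := abs_parallelogram_le_c2Norm (isCompact_baseTri e) (convex_baseTri e)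
      (interior_baseTri_nonempty hT) hf (hmem (shiftRow i s X)) (hmem X) (hmem (shiftRow i s Y))
      (hmem Y) (by rw [e0, e1, e2, e3, hs]; module)
    rw [hw, neg_one_mul, ← sub_eq_add_neg]
    refine h.trans ?_
    gcongr
    exact norm_iterMap_sub_le he0 hsum j.2.le (hp1.trans hp3.symm) hz
  · have h := abs_parallelogram_le_c2Norm (isCompact_baseTri e) (convex_baseTri e)
      (interior_baseTri_nonempty hT) hf (hmem (shiftRow i s X)) (hmem X) (hmem Y)
      (hmem (shiftRow i s Y)) (by rw [e0, e1, e2, e3, hs]; module)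
    rw [hw, one_mul, ← neg_sub (f _) (f (iterMap e (List.ofFn Y) z)), ← sub_eq_add_neg]
    refine h.trans ?_
    gcongr
    exact norm_iterMap_sub_le he0 hsum j.2.le (hp1.trans hp2.symm) hz

lemma abs_rwHat_zero_comp_le {n : ℕ} {K : Fin n → F2 × F2} (hK : 1 ≤ vK K) {z : Pt}
    (hz : z ∈ baseTri e) :
    |rwHat (fun X => f (iterMap e (List.ofFn X) z)) K 0| ≤
      2 * √2 * Metric.diam (baseTri e) * c2Norm (baseTri e) f / 2 ^ (2 * vK K) := by
  obtain ⟨i, hi, hiv⟩ := exists_vK_eq hK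
  have hM := c2Norm_nonneg (isCompact_baseTri e) ⟨z, hz⟩ hf
  have hd : 0 ≤ Metric.diam (baseTri e) := Metric.diam_nonneg
  have hcard : ((Rset K 0).card : ℝ) * 2 ^ (i : ℕ) ≤ 4 ^ n := by
    have h := card_Rset_mul_le K 0
    rw [← hiv] at h
    exact_mod_cast h
  have h1 := abs_sum_mul_walR_le K (S := Rset K 0)
    (fun X _ => abs_shiftRow_difference_le he0 hsum hT hf X i (sigF (K i)) hz)
  rw [rwHat, sum_mul_walR_eq_half K i (sigF (K i))
    (fun X hX => shiftRow_last_mem_Rset hiv hK _ hX), walRow_sigF_of_ne hi]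
  simp only [neg_one_mul, ← sub_eq_add_neg]
  rw [abs_mul, abs_mul, abs_of_pos (by positivity), abs_of_pos (by norm_num : (0:ℝ) < 2⁻¹), ← hiv]
  set M := c2Norm (baseTri e) f
  set d := Metric.diam (baseTri e)
  calc _ ≤ ((4:ℝ) ^ n)⁻¹ * (2⁻¹ * ((Rset K 0).card * (√2 * M * ((2 ^ (i : ℕ))⁻¹ * d)))) := by
        gcongr
    _ = ((4:ℝ) ^ n)⁻¹ * (((Rset K 0).card * 2 ^ (i : ℕ)) *
          (2⁻¹ * (√2 * M * d) * ((2 ^ (i : ℕ))⁻¹ * (2 ^ (i : ℕ))⁻¹))) := by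
        field_simp
    _ ≤ ((4:ℝ) ^ n)⁻¹ * (4 ^ n *
          (2⁻¹ * (√2 * M * d) * ((2 ^ (i : ℕ))⁻¹ * (2 ^ (i : ℕ))⁻¹))) := by
        gcongr
    _ = 2 * √2 * d * M / 2 ^ (2 * ((i : ℕ) + 1)) := by
        rw [show 2 * ((i : ℕ) + 1) = i + i + 2 by ring, pow_add, pow_add]
        field_simp

lemma abs_rwHat_comp_le {n : ℕ} {K : Fin n → F2 × F2} {w : ℕ} (hw1 : 1 ≤ w) (hw : w < vK K)
    {z : Pt} (hz : z ∈ baseTri e) :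
    |rwHat (fun X => f (iterMap e (List.ofFn X) z)) K w| ≤
      4 * Metric.diam (baseTri e) ^ 2 * c2Norm (baseTri e) f / 2 ^ (2 * vK K) := by
  obtain ⟨i, hi, hiv⟩ := exists_vK_eq (hw1.trans hw.le)
  obtain ⟨j, hj⟩ : ∃ j : Fin n, (j : ℕ) + 1 = w := ⟨⟨w - 1, by have := vK_le K; omega⟩, by
    simp only; omega⟩
  obtain ⟨m, hm⟩ : ∃ m : ℕ, (i : ℕ) = j + m := ⟨i - j, by omega⟩
  have hji : j < i := by rw [Fin.lt_def]; omega
  have hM := c2Norm_nonneg (isCompact_baseTri e) ⟨z, hz⟩ hf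
  have hd : 0 ≤ Metric.diam (baseTri e) := Metric.diam_nonneg
  have hcard : ((Rset K w).card : ℝ) * 2 ^ m ≤ 4 ^ n := by
    have h := card_Rset_mul_le K w
    rw [show vK K - max w 1 = m by omega] at h
    exact_mod_cast h
  have h1 := abs_sum_mul_walR_le K (S := Rset K w) (fun X hX => by
    have hXj : X j ∈ pSet (K j) := by
      rcases (mem_Rset.1 hX).2 with h | ⟨k, hk, h⟩
      · omega
      · obtain rfl : k = j := Fin.ext (by omega)
        exact h
    exact abs_shiftRow_second_difference_le he0 hsum hT hf hji hXj (sigF (K i)) hz)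
  rw [rwHat, sum_mul_walR_eq_half K i (sigF (K i))
    (fun X hX => shiftRow_last_mem_Rset hiv hw _ hX), walRow_sigF_of_ne hi]
  simp only [neg_one_mul, ← sub_eq_add_neg]
  rw [sum_mul_walR_eq_half K j (sigF (K j)) (fun X hX => shiftRow_sigF_mem_Rset hj hX)]
  rw [abs_mul, abs_mul, abs_mul, abs_of_pos (by positivity),
    abs_of_pos (by norm_num : (0:ℝ) < 2⁻¹), ← hiv]
  set M := c2Norm (baseTri e) f
  set d := Metric.diam (baseTri e)
  calc _ ≤ ((4:ℝ) ^ n)⁻¹ * (2⁻¹ * (2⁻¹ * ((Rset K w).card *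
          (2 * M * ((2 ^ (j : ℕ))⁻¹ * d) * ((2 ^ (i : ℕ))⁻¹ * d))))) := by
        gcongr
    _ = ((4:ℝ) ^ n)⁻¹ * (((Rset K w).card * 2 ^ m) *
          (2⁻¹ * M * d ^ 2 * ((2 ^ (i : ℕ))⁻¹ * (2 ^ (i : ℕ))⁻¹))) := by
        rw [hm, pow_add]
        field_simp
    _ ≤ ((4:ℝ) ^ n)⁻¹ * (4 ^ n *
          (2⁻¹ * M * d ^ 2 * ((2 ^ (i : ℕ))⁻¹ * (2 ^ (i : ℕ))⁻¹))) := by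
        gcongr
    _ = 2 * d ^ 2 * M / 2 ^ (2 * ((i : ℕ) + 1)) := by
        rw [show 2 * ((i : ℕ) + 1) = i + i + 2 by ring, pow_add, pow_add]
        field_simp
    _ ≤ 4 * d ^ 2 * M / 2 ^ (2 * ((i : ℕ) + 1)) := by
        gcongr
        norm_num

/-- A pointwise bound on Walsh coefficients passes to the discretized function. -/
lemma abs_rwHat_discF_le {n : ℕ} {K : Fin n → F2 × F2} {w : ℕ} {B : ℝ}
    (hB : ∀ z ∈ baseTri e, |rwHat (fun X => f (iterMap e (List.ofFn X) z)) K w| ≤ B) :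
    |rwHat (discF (e (1, 0), e (0, 1), e (1, 1)) f) K w| ≤ B := by
  have hTc : IsCompact (baseTri e) := isCompact_baseTri e
  have hne : (baseTri e).Nonempty := (interior_baseTri_nonempty hT).mono interior_subset
  have hInt : ∀ X : Fin n → F2 × F2,
      IntegrableOn (fun z => f (iterMap e (List.ofFn X) z)) (baseTri e) := fun X => by
    obtain ⟨r, c, -, h⟩ := iterMap_eq e (List.ofFn X)
    refine ContinuousOn.integrableOn_compact hTc (hf.continuousOn.comp ?_
      fun z hz => iterMap_mem e he0 hsum _ hz)
    rw [show iterMap e (List.ofFn X) = fun z => r • z + c from funext h]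
    fun_prop
  have hB0 : 0 ≤ B := (abs_nonneg _).trans (hB _ hne.some_mem)
  have heq : rwHat (discF (e (1, 0), e (0, 1), e (1, 1)) f) K w =
      (volume (baseTri e)).toReal⁻¹ *
        ∫ z in baseTri e, rwHat (fun X => f (iterMap e (List.ofFn X) z)) K w := by
    simp only [rwHat, discF_eq e he0 hsum]
    rw [integral_const_mul, integral_finsetSum _ fun X _ => (hInt X).mul_const _]
    simp only [integral_mul_const, Finset.mul_sum]
    refine Finset.sum_congr rfl fun X _ => ?_
    ring
  have hnorm := norm_setIntegral_le_of_norm_le_const (μ := volume)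
    (f := fun z => rwHat (fun X => f (iterMap e (List.ofFn X) z)) K w) hTc.measure_lt_top hB
  rw [Real.norm_eq_abs, Measure.real] at hnorm
  rw [heq, abs_mul, abs_of_nonneg (by positivity)]
  calc _ ≤ (volume (baseTri e)).toReal⁻¹ * (B * (volume (baseTri e)).toReal) := by gcongr
    _ = (volume (baseTri e)).toReal⁻¹ * (volume (baseTri e)).toReal * B := by ring
    _ ≤ B := mul_le_of_le_one_left hB0 inv_mul_le_one

end Differences

/-- Lemma 9. Bounds on the Walsh coefficients of the `n`-th
discretized function `F_n` of `f ∈ C²(T)` for the centred triangle `T`. -/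
theorem statement19 (e : F2 × F2 → Pt) (he0 : e (0, 0) = 0)
    (hsum : e (1, 0) + e (0, 1) + e (1, 1) = 0)
    (hT : AffineIndependent ℝ ![e (1, 0), e (0, 1), e (1, 1)])
    {n : ℕ} (f : Pt → ℝ) (hf : ContDiffOn ℝ 2 f (tri (e (1, 0)) (e (0, 1)) (e (1, 1))))
    (K : Fin n → F2 × F2) (hK : 1 ≤ vK K) :
    |rwHat (discF (e (1, 0), e (0, 1), e (1, 1)) f) K 0| ≤
      2 * Real.sqrt 2 * Metric.diam (tri (e (1, 0)) (e (0, 1)) (e (1, 1))) *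
        c2Norm (tri (e (1, 0)) (e (0, 1)) (e (1, 1))) f / 2 ^ (2 * vK K) ∧
    (∀ w : ℕ, 1 ≤ w → w < vK K →
      |rwHat (discF (e (1, 0), e (0, 1), e (1, 1)) f) K w| ≤
        4 * Metric.diam (tri (e (1, 0)) (e (0, 1)) (e (1, 1))) ^ 2 *
          c2Norm (tri (e (1, 0)) (e (0, 1)) (e (1, 1))) f / 2 ^ (2 * vK K)) ∧
    |fhat (discF (e (1, 0), e (0, 1), e (1, 1)) f) K| ≤
      max (2 * Real.sqrt 2 * Metric.diam (tri (e (1, 0)) (e (0, 1)) (e (1, 1))))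
          (4 * Metric.diam (tri (e (1, 0)) (e (0, 1)) (e (1, 1))) ^ 2) *
        c2Norm (tri (e (1, 0)) (e (0, 1)) (e (1, 1))) f * vK K / 2 ^ (2 * vK K) := by
  have h0 := abs_rwHat_discF_le he0 hsum hT hf
    (fun z hz => abs_rwHat_zero_comp_le he0 hsum hT hf hK hz)
  have hw : ∀ w : ℕ, 1 ≤ w → w < vK K → _ := fun w h1 h2 =>
    abs_rwHat_discF_le he0 hsum hT hf
      (fun z hz => abs_rwHat_comp_le he0 hsum hT hf (K := K) h1 h2 hz)
  refine ⟨h0, hw, ?_⟩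
  have hM : 0 ≤ c2Norm (baseTri e) f := c2Norm_nonneg (isCompact_baseTri e)
    ((interior_baseTri_nonempty hT).mono interior_subset) hf
  rw [fhat_eq_sum_rwHat hK]
  refine (Finset.abs_sum_le_sum_abs _ _).trans ?_
  refine (Finset.sum_le_card_nsmul _ _
    (max (2 * √2 * Metric.diam (baseTri e)) (4 * Metric.diam (baseTri e) ^ 2) *
      c2Norm (baseTri e) f / 2 ^ (2 * vK K)) fun w hwv => ?_).trans_eq ?_
  · rcases Nat.eq_zero_or_pos w with rfl | hpos
    · refine h0.trans ?_
      gcongr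
      exact le_max_left _ _
    · refine (hw w hpos (Finset.mem_range.1 hwv)).trans ?_
      gcongr
      exact le_max_right _ _
  · rw [Finset.card_range, nsmul_eq_mul]
    simp only [baseTri]
    ring
end
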